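/- Let T > 0 and n ≥ 3 be an integer, and let h be a smooth real function with supp h ⊆ (0, T/3] ∪ [2T/3, T) and ∫₀^T t^k h(t) dt = 0 for 0 ≤ k < n. Let V : [0,∞) × [0,∞) → ℝ be a bounded continuous function, smooth on (0,∞) × [0,∞), with ∂_t V = ∂_{zz} V for t, z > 0, V(t,0) = h(t), V(0,·) = 0, and such that t ↦ |V(t,·)|_{H^{3,3}(ℝ₊)} is finite and locally bounded. Let χ ∈ C^∞([-1,1],[0,1]) with χ(y) = 1 for |y| ≥ 2/3 and χ(y) = 0 for |y| ≤ 1/3, and let φ ∈ C^∞([-1,1],[0,1]) with φ(±1) = 0 and |φ'(y)| = 1 for |y| ≥ 1/4. For ε ∈ (0,1) define f_W^ε(t,y) := − (χ''(y)/φ(y)²) · (φ(y)/√ε)² · V(t, φ(y)/√ε) − 2 (χ'(y)/φ(y)³) φ'(y) · (φ(y)/√ε)³ · (∂_z V)(t, φ(y)/√ε). Then there exists a constant C_W > 0 such that for every ε ∈ (0,1), every smooth function W : [0,∞) × [-1,1] → ℝ satisfying ∂_t W = ε ∂_{yy} W + f_W^ε on (0,∞) × (-1,1), W(t,±1) = 0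 for all t ≥ 0 and W(0,·) = 0, and every t ≥ 0: sup_{y} |W(t,y)| + sup_{y} |∂_y W(t,y)| ≤ ε^{-3/4} C_W. -/

import Mathlib

open MeasureTheory Set Finset Function

/-- The weighted Sobolev norm `|g|_{H^{s,m}(ℝ₊)}` of the paper. -/
noncomputable def weightedSobolevNorm (s m : ℕ) (g : ℝ → ℝ) : ℝ :=
  Real.sqrt (∑ α ∈ Finset.range (s + 1),
    ∫ z in Set.Ioi (0:ℝ), (1 + z ^ 2) ^ m * (iteratedDeriv α g z) ^ 2)

/-- The source term `f_W^ε` of the technical profile equation (4.9) of the paper: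
`f_W^ε(t,y) = -(χ''(y)/φ(y)²)(φ(y)/√ε)² V(t,φ(y)/√ε)
 - 2(χ'(y)/φ(y)³)φ'(y)(φ(y)/√ε)³ (∂_z V)(t,φ(y)/√ε)`
(extended by `0` where `χ' = χ'' = 0`, which is automatic here since division by
zero yields zero). -/
noncomputable def fWsource (χ φ : ℝ → ℝ) (V : ℝ → ℝ → ℝ) (ε t y : ℝ) : ℝ :=
  -(iteratedDeriv 2 χ y / (φ y) ^ 2) * (φ y / Real.sqrt ε) ^ 2 *
      V t (φ y / Real.sqrt ε)
    - 2 * (deriv χ y / (φ y) ^ 3) * deriv φ y * (φ y / Real.sqrt ε) ^ 3 *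
      deriv (V t) (φ y / Real.sqrt ε)

/-- Integral over the half-line of a polynomial times a Gaussian, tested against a time signal. -/
noncomputable def selfSimilarIntegral (p : Polynomial ℝ) (m : ℕ) (g : ℝ → ℝ) (t z : ℝ) : ℝ :=
  ∫ s in Set.Ioi (0:ℝ),
    s ^ m * (p.eval (z * s) * Real.exp (-(z * s) ^ 2)) * g (t - 1 / (4 * s ^ 2))

/-- The polynomial `q` with `(p(x) e^{-x²})' = q(x) e^{-x²}`. -/
noncomputable def gaussDerivative (p : Polynomial ℝ) : Polynomial ℝ :=
  Polynomial.derivative p - 2 * Polynomial.X * p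

/-- The bounded solution of the heat equation on the half-line with boundary data `g`. -/
noncomputable def boundaryHeat (g : ℝ → ℝ) (t z : ℝ) : ℝ :=
  2 / Real.sqrt Real.pi *
    ∫ u in Set.Ioi (0:ℝ), Real.exp (-u ^ 2) * g (t - z ^ 2 / (4 * u ^ 2))

lemma exists_abs_eval_mul_exp_neg_sq_le (p : Polynomial ℝ) :
    ∃ C > (0:ℝ), ∀ x : ℝ, |p.eval x| * Real.exp (-x ^ 2) ≤ C * Real.exp (-x ^ 2 / 2) := by
  induction p using Polynomial.induction_on' with
  | add p q hp hq =>
    obtain ⟨C, hC, h1⟩ := hp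
    obtain ⟨D, hD, h2⟩ := hq
    refine ⟨C + D, by positivity, fun x => ?_⟩
    rw [Polynomial.eval_add]
    have := mul_le_mul_of_nonneg_right (abs_add_le (p.eval x) (q.eval x))
      (Real.exp_pos (-x ^ 2)).le
    linarith [h1 x, h2 x]
  | monomial n a =>
    refine ⟨(|a| + 1) * n.factorial * Real.exp (1 / 2), by positivity, fun x => ?_⟩
    have h1 : |x| ^ n ≤ n.factorial * Real.exp |x| := by
      have := Real.pow_div_factorial_le_exp |x| (abs_nonneg x) n
      rwa [div_le_iff₀' (by positivity)] at this
    have h2 : Real.exp |x| * Real.exp (-x ^ 2) ≤ Real.exp (1 / 2) * Real.exp (-x ^ 2 / 2) := by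
      rw [← Real.exp_add, ← Real.exp_add]
      apply Real.exp_le_exp.mpr
      nlinarith [sq_nonneg (|x| - 1), sq_abs x]
    rw [Polynomial.eval_monomial, abs_mul, abs_pow]
    calc |a| * |x| ^ n * Real.exp (-x ^ 2)
        ≤ (|a| + 1) * (n.factorial * Real.exp |x|) * Real.exp (-x ^ 2) := by
          gcongr
          linarith
      _ = (|a| + 1) * n.factorial * (Real.exp |x| * Real.exp (-x ^ 2)) := by ring
      _ ≤ (|a| + 1) * n.factorial * (Real.exp (1 / 2) * Real.exp (-x ^ 2 / 2)) := by gcongr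
      _ = _ := by ring

lemma integrableOn_pow_mul_exp_neg_mul_sq (m : ℕ) {b : ℝ} (hb : 0 < b) :
    IntegrableOn (fun s : ℝ => s ^ m * Real.exp (-b * s ^ 2)) (Set.Ioi 0) := by
  have := integrableOn_rpow_mul_exp_neg_mul_sq hb (s := m) (by
    have : (0:ℝ) ≤ m := Nat.cast_nonneg m
    linarith)
  simpa [Real.rpow_natCast] using this

lemma integrableOn_exp_neg_sq : IntegrableOn (fun u : ℝ => Real.exp (-u ^ 2)) (Set.Ioi 0) := by
  simpa using integrableOn_pow_mul_exp_neg_mul_sq 0 one_pos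

section

variable {g g' : ℝ → ℝ} {M M' : ℝ}

lemma selfSimilarIntegral_measurable (hg : Continuous g) (p : Polynomial ℝ) (m : ℕ) (t z : ℝ) :
    AEStronglyMeasurable (fun s : ℝ =>
      s ^ m * (p.eval (z * s) * Real.exp (-(z * s) ^ 2)) * g (t - 1 / (4 * s ^ 2)))
      (volume.restrict (Set.Ioi 0)) := by
  have h1 : Measurable g := hg.measurable
  have h2 : Measurable (fun s : ℝ => p.eval (z * s)) :=
    (p.continuous.comp (continuous_const.mul continuous_id)).measurable
  apply Measurable.aestronglyMeasurable
  fun_prop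

lemma abs_integrand_le (p : Polynomial ℝ) {C : ℝ}
    (hC : ∀ x : ℝ, |p.eval x| * Real.exp (-x ^ 2) ≤ C * Real.exp (-x ^ 2 / 2))
    (hM : ∀ t, |g t| ≤ M) (m : ℕ) (t z : ℝ) {s : ℝ} (hs : 0 < s) :
    |s ^ m * (p.eval (z * s) * Real.exp (-(z * s) ^ 2)) * g (t - 1 / (4 * s ^ 2))|
      ≤ C * M * (s ^ m * Real.exp (-(z ^ 2 / 2) * s ^ 2)) := by
  rw [abs_mul, abs_mul, abs_mul, abs_of_pos (pow_pos hs m), abs_of_pos (Real.exp_pos _)]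
  have h1 := hC (z * s)
  have h2 : -(z * s) ^ 2 / 2 = -(z ^ 2 / 2) * s ^ 2 := by ring
  rw [h2] at h1
  have hC0 : 0 ≤ C * Real.exp (-(z ^ 2 / 2) * s ^ 2) := le_trans (by positivity) h1
  calc _ ≤ s ^ m * (C * Real.exp (-(z ^ 2 / 2) * s ^ 2)) * M := by
        gcongr
        exact hM _
    _ = _ := by ring

lemma selfSimilarIntegral_integrable (hg : Continuous g) (hM : ∀ t, |g t| ≤ M)
    (p : Polynomial ℝ) (m : ℕ) (t : ℝ) {z : ℝ} (hz : 0 < z) :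
    IntegrableOn (fun s : ℝ =>
      s ^ m * (p.eval (z * s) * Real.exp (-(z * s) ^ 2)) * g (t - 1 / (4 * s ^ 2)))
      (Set.Ioi 0) := by
  obtain ⟨C, -, hC⟩ := exists_abs_eval_mul_exp_neg_sq_le p
  refine Integrable.mono'
    ((integrableOn_pow_mul_exp_neg_mul_sq m (b := z ^ 2 / 2) (by positivity)).const_mul (C * M))
    (selfSimilarIntegral_measurable hg p m t z) ?_
  filter_upwards [ae_restrict_mem measurableSet_Ioi] with s hs
  exact abs_integrand_le p hC hM m t z hs

lemma exists_abs_selfSimilarIntegral_le (hM : ∀ t, |g t| ≤ M) (p : Polynomial ℝ) (m : ℕ) :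
    ∃ C ≥ (0:ℝ), ∀ t, ∀ z > (0:ℝ), |selfSimilarIntegral p m g t z| ≤ C / z ^ (m + 1) := by
  obtain ⟨C, hC0, hC⟩ := exists_abs_eval_mul_exp_neg_sq_le p
  have hM0 : 0 ≤ M := (abs_nonneg _).trans (hM 0)
  refine ⟨C * M * ∫ u in Set.Ioi (0:ℝ), u ^ m * Real.exp (-(1 / 2) * u ^ 2),
    mul_nonneg (by positivity) (setIntegral_nonneg measurableSet_Ioi fun u hu =>
      mul_nonneg (pow_nonneg (le_of_lt hu) m) (Real.exp_pos _).le), fun t z hz => ?_⟩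
  rw [← Real.norm_eq_abs, selfSimilarIntegral]
  have h1 : ‖∫ s in Set.Ioi (0:ℝ),
      s ^ m * (p.eval (z * s) * Real.exp (-(z * s) ^ 2)) * g (t - 1 / (4 * s ^ 2))‖ ≤
      ∫ s in Set.Ioi (0:ℝ), C * M * (s ^ m * Real.exp (-(z ^ 2 / 2) * s ^ 2)) := by
    refine norm_integral_le_of_norm_le
      ((integrableOn_pow_mul_exp_neg_mul_sq m (b := z ^ 2 / 2) (by positivity)).const_mul (C * M)) ?_
    filter_upwards [ae_restrict_mem measurableSet_Ioi] with s hs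
    exact abs_integrand_le p hC hM m t z hs
  refine h1.trans (le_of_eq ?_)
  have h2 := integral_comp_mul_left_Ioi (fun u : ℝ => u ^ m * Real.exp (-(1 / 2) * u ^ 2)) 0 hz
  rw [mul_zero, smul_eq_mul] at h2
  rw [integral_const_mul, mul_div_assoc]
  congr 1
  have h3 : ∀ s : ℝ, s ^ m * Real.exp (-(z ^ 2 / 2) * s ^ 2) =
      (z ^ m)⁻¹ * ((z * s) ^ m * Real.exp (-(1 / 2) * (z * s) ^ 2)) := by
    intro s
    have : -(1 / 2) * (z * s) ^ 2 = -(z ^ 2 / 2) * s ^ 2 := by ring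
    rw [this, mul_pow]
    field_simp
  simp_rw [h3]
  rw [integral_const_mul, h2, pow_succ]
  field_simp

lemma hasDerivAt_selfSimilarIntegral_space (hg : Continuous g) (hM : ∀ t, |g t| ≤ M)
    (p : Polynomial ℝ) (m : ℕ) (t : ℝ) {z : ℝ} (hz : 0 < z) :
    HasDerivAt (selfSimilarIntegral p m g t)
      (selfSimilarIntegral (gaussDerivative p) (m + 1) g t z) z := by
  obtain ⟨C, hC0, hC⟩ := exists_abs_eval_mul_exp_neg_sq_le (gaussDerivative p)
  have hM0 : 0 ≤ M := (abs_nonneg _).trans (hM 0)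
  refine (hasDerivAt_integral_of_dominated_loc_of_deriv_le
    (F' := fun w s => s ^ (m + 1) * ((gaussDerivative p).eval (w * s) *
      Real.exp (-(w * s) ^ 2)) * g (t - 1 / (4 * s ^ 2)))
    (bound := fun s => C * M * (s ^ (m + 1) * Real.exp (-((z / 2) ^ 2 / 2) * s ^ 2)))
    (Ioi_mem_nhds (show z / 2 < z by linarith))
    (Filter.Eventually.of_forall fun w => selfSimilarIntegral_measurable hg p m t w)
    (selfSimilarIntegral_integrable hg hM p m t hz)
    (selfSimilarIntegral_measurable hg (gaussDerivative p) (m + 1) t z) ?_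
    ((integrableOn_pow_mul_exp_neg_mul_sq (m + 1) (by positivity)).const_mul (C * M)) ?_).2
  · filter_upwards [ae_restrict_mem measurableSet_Ioi] with s hs w hw
    refine (abs_integrand_le (gaussDerivative p) hC hM (m + 1) t w hs).trans ?_
    have hs' : (0:ℝ) < s := hs
    have hw' : z / 2 < w := hw
    have : (z / 2) ^ 2 ≤ w ^ 2 := by gcongr
    gcongr
  · refine Filter.Eventually.of_forall fun s w _ => ?_
    have h1 : HasDerivAt (fun w : ℝ => w * s) s w := by simpa using (hasDerivAt_id w).mul_const s
    have h2 : HasDerivAt (fun w : ℝ => p.eval (w * s)) (p.derivative.eval (w * s) * s) w :=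
      HasDerivAt.comp (h₂ := fun x => p.eval x) w (p.hasDerivAt (w * s)) h1
    have h3 := ((h2.mul ((h1.pow 2).neg.exp)).const_mul (s ^ m)).mul_const
      (g (t - 1 / (4 * s ^ 2)))
    refine h3.congr_deriv ?_
    simp only [gaussDerivative, Polynomial.eval_sub, Polynomial.eval_mul, Polynomial.eval_X,
      Polynomial.eval_ofNat, Pi.pow_apply, Pi.neg_apply]
    push_cast
    ring

lemma hasDerivAt_boundaryHeat_time (hg : ∀ x, HasDerivAt g (g' x) x) (hg' : Continuous g')
    (hM : ∀ t, |g t| ≤ M) (hM' : ∀ t, |g' t| ≤ M') (t z : ℝ) :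
    HasDerivAt (fun τ => boundaryHeat g τ z) (boundaryHeat g' t z) t := by
  have hgc : Continuous g := continuous_iff_continuousAt.mpr fun x => (hg x).continuousAt
  have hgm := hgc.measurable
  have hgm' := hg'.measurable
  have hb : ∀ (f : ℝ → ℝ) (K : ℝ), (∀ t, |f t| ≤ K) → ∀ τ u : ℝ,
      ‖Real.exp (-u ^ 2) * f (τ - z ^ 2 / (4 * u ^ 2))‖ ≤ K * Real.exp (-u ^ 2) := by
    intro f K hK τ u
    rw [Real.norm_eq_abs, abs_mul, abs_of_pos (Real.exp_pos _), mul_comm]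
    gcongr
    exact hK _
  have hmeas : ∀ f : ℝ → ℝ, Measurable f → ∀ τ : ℝ, AEStronglyMeasurable
      (fun u : ℝ => Real.exp (-u ^ 2) * f (τ - z ^ 2 / (4 * u ^ 2)))
      (volume.restrict (Set.Ioi 0)) := by
    intro f hf τ
    apply Measurable.aestronglyMeasurable
    fun_prop
  refine HasDerivAt.const_mul _ (hasDerivAt_integral_of_dominated_loc_of_deriv_le
    (bound := fun u => M' * Real.exp (-u ^ 2)) Filter.univ_mem
    (Filter.Eventually.of_forall (hmeas g hgm))
    ((integrableOn_exp_neg_sq.const_mul M).mono' (hmeas g hgm t)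
      (Filter.Eventually.of_forall (hb g M hM t)))
    (hmeas g' hgm' t) (Filter.Eventually.of_forall fun u τ _ => hb g' M' hM' τ u)
    (integrableOn_exp_neg_sq.const_mul M') ?_).2
  refine Filter.Eventually.of_forall fun u τ _ => ?_
  have h1 : HasDerivAt (fun τ : ℝ => τ - z ^ 2 / (4 * u ^ 2)) 1 τ := (hasDerivAt_id τ).sub_const _
  have h2 := ((hg (τ - z ^ 2 / (4 * u ^ 2))).comp τ h1).const_mul (Real.exp (-u ^ 2))
  simpa using h2

lemma continuous_boundaryHeat (hg : Continuous g) (hM : ∀ t, |g t| ≤ M) :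
    Continuous fun q : ℝ × ℝ => boundaryHeat g q.1 q.2 := by
  have hgm := hg.measurable
  refine continuous_const.mul (continuous_of_dominated (bound := fun u => M * Real.exp (-u ^ 2))
    (fun q => ?_) (fun q => Filter.Eventually.of_forall fun u => ?_)
    (integrableOn_exp_neg_sq.const_mul M) (Filter.Eventually.of_forall fun u => ?_))
  · apply Measurable.aestronglyMeasurable
    fun_prop
  · rw [Real.norm_eq_abs, abs_mul, abs_of_pos (Real.exp_pos _), mul_comm]
    gcongr
    exact hM _
  · fun_prop

lemma boundaryHeat_zero_right (t : ℝ) : boundaryHeat g t 0 = g t := by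
  have h1 := integral_gaussian_Ioi 1
  simp only [neg_mul, one_mul, div_one] at h1
  have h2 : Real.sqrt Real.pi ≠ 0 := by positivity
  simp only [boundaryHeat, ne_eq, OfNat.ofNat_ne_zero, not_false_eq_true, zero_pow, zero_div,
    sub_zero]
  rw [integral_mul_const, h1]
  field_simp

lemma abs_boundaryHeat_le (hM : ∀ t, |g t| ≤ M) (t z : ℝ) : |boundaryHeat g t z| ≤ M := by
  have h1 := integral_gaussian_Ioi 1
  simp only [neg_mul, one_mul, div_one] at h1
  have h2 : 0 < Real.sqrt Real.pi := by positivity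
  rw [boundaryHeat, abs_mul, abs_of_pos (by positivity)]
  have h3 : ‖∫ u in Set.Ioi (0:ℝ), Real.exp (-u ^ 2) * g (t - z ^ 2 / (4 * u ^ 2))‖ ≤
      ∫ u in Set.Ioi (0:ℝ), Real.exp (-u ^ 2) * M := by
    refine norm_integral_le_of_norm_le (integrableOn_exp_neg_sq.mul_const M)
      (Filter.Eventually.of_forall fun u => ?_)
    rw [Real.norm_eq_abs, abs_mul, abs_of_pos (Real.exp_pos _)]
    gcongr
    exact hM _
  rw [integral_mul_const, h1, Real.norm_eq_abs] at h3
  calc _ ≤ 2 / Real.sqrt Real.pi * (Real.sqrt Real.pi / 2 * M) := by gcongr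
    _ = M := by field_simp

lemma boundaryHeat_eq (t : ℝ) {z : ℝ} (hz : 0 < z) :
    boundaryHeat g t z = 2 / Real.sqrt Real.pi * (z * selfSimilarIntegral 1 0 g t z) := by
  have h2 := integral_comp_mul_left_Ioi'
    (fun u : ℝ => Real.exp (-u ^ 2) * g (t - z ^ 2 / (4 * u ^ 2))) 0 hz
  rw [mul_zero, smul_eq_mul] at h2
  rw [boundaryHeat, ← h2, selfSimilarIntegral]
  congr 2
  refine setIntegral_congr_fun measurableSet_Ioi fun s hs => ?_
  have hs' : s ≠ 0 := ne_of_gt hs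
  have : z ^ 2 / (4 * (z * s) ^ 2) = 1 / (4 * s ^ 2) := by field_simp
  simp [this]

lemma hasDerivAt_boundaryHeat_space (hg : Continuous g) (hM : ∀ t, |g t| ≤ M) (t : ℝ) {z : ℝ}
    (hz : 0 < z) :
    HasDerivAt (boundaryHeat g t)
      (2 / Real.sqrt Real.pi * selfSimilarIntegral (1 - 2 * Polynomial.X ^ 2) 0 g t z) z := by
  have h1 := (((hasDerivAt_id z).mul (hasDerivAt_selfSimilarIntegral_space hg hM 1 0 t hz)).const_mul
    (2 / Real.sqrt Real.pi))
  have h2 : boundaryHeat g t =ᶠ[nhds z]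
      fun w => 2 / Real.sqrt Real.pi * (w * selfSimilarIntegral 1 0 g t w) := by
    filter_upwards [Ioi_mem_nhds hz] with w hw
    exact boundaryHeat_eq t hw
  refine (h1.congr_of_eventuallyEq h2).congr_deriv ?_
  congr 1
  simp only [selfSimilarIntegral, id, one_mul]
  rw [← integral_const_mul, ← integral_add (selfSimilarIntegral_integrable hg hM 1 0 t hz)
    ((selfSimilarIntegral_integrable hg hM _ _ t hz).const_mul z)]
  congr 1
  ext s
  simp only [gaussDerivative, Polynomial.eval_sub, Polynomial.eval_mul, Polynomial.eval_X,
      Polynomial.eval_ofNat, Polynomial.eval_one, Polynomial.derivative_one, Polynomial.eval_zero,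
      Polynomial.eval_pow]
  ring

lemma boundaryHeat_deriv_eq (hg : ∀ x, HasDerivAt g (g' x) x) (hg' : Continuous g')
    (hM : ∀ t, |g t| ≤ M) (hM' : ∀ t, |g' t| ≤ M') (t : ℝ) {z : ℝ} (hz : 0 < z) :
    boundaryHeat g' t z = 2 / Real.sqrt Real.pi *
      selfSimilarIntegral (gaussDerivative (1 - 2 * Polynomial.X ^ 2)) 1 g t z := by
  have hgc : Continuous g := continuous_iff_continuousAt.mpr fun x => (hg x).continuousAt
  rw [boundaryHeat_eq t hz]
  congr 1
  rw [← sub_eq_zero]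
  have i1 := (selfSimilarIntegral_integrable hg' hM' 1 0 t hz).const_mul z
  have i2 := selfSimilarIntegral_integrable hgc hM
    (gaussDerivative (1 - 2 * Polynomial.X ^ 2)) 1 t hz
  have h0 : ∫ s in Set.Ioi (0:ℝ), (z * (s ^ 0 * ((1 : Polynomial ℝ).eval (z * s) *
      Real.exp (-(z * s) ^ 2)) * g' (t - 1 / (4 * s ^ 2))) -
      s ^ 1 * ((gaussDerivative (1 - 2 * Polynomial.X ^ 2)).eval (z * s) *
      Real.exp (-(z * s) ^ 2)) * g (t - 1 / (4 * s ^ 2))) =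
      0 - (2 * z * (0:ℝ) ^ 3 * Real.exp (-(z * 0) ^ 2) * g (t - 1 / (4 * 0 ^ 2))) := by
    refine integral_Ioi_of_hasDerivAt_of_tendsto
      (f := fun s : ℝ => 2 * z * s ^ 3 * Real.exp (-(z * s) ^ 2) * g (t - 1 / (4 * s ^ 2)))
      ?_ (fun s hs => ?_) (i1.sub i2) ?_
    · refine ContinuousAt.continuousWithinAt ?_
      rw [ContinuousAt]
      have h1 : Filter.Tendsto (fun s : ℝ => 2 * z * s ^ 3 * Real.exp (-(z * s) ^ 2)) (nhds 0)
          (nhds 0) := by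
        have : Continuous (fun s : ℝ => 2 * z * s ^ 3 * Real.exp (-(z * s) ^ 2)) := by fun_prop
        simpa using this.tendsto 0
      have h2 := h1.zero_mul_isBoundedUnder_le (g := fun s : ℝ => g (t - 1 / (4 * s ^ 2)))
        (Filter.isBoundedUnder_of ⟨M, fun s => hM _⟩)
      simpa using h2
    · have hs' : s ≠ 0 := ne_of_gt hs
      have h1 : HasDerivAt (fun s : ℝ => z * s) z s := by
        simpa using (hasDerivAt_id s).const_mul z
      have h2 : HasDerivAt (fun s : ℝ => t - 1 / (4 * s ^ 2)) (1 / (2 * s ^ 3)) s := by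
        have h3 : HasDerivAt (fun s : ℝ => 4 * s ^ 2) (4 * (2 * s)) s := by
          simpa using (hasDerivAt_pow 2 s).const_mul 4
        have h4 := ((hasDerivAt_const s (1:ℝ)).div h3 (by positivity)).const_sub t
        refine h4.congr_deriv ?_
        field_simp
        ring
      have h5 := ((((hasDerivAt_pow 3 s).const_mul (2 * z)).mul ((h1.pow 2).neg.exp)).mul
        ((hg (t - 1 / (4 * s ^ 2))).comp s h2))
      refine h5.congr_deriv ?_
      simp only [gaussDerivative, Polynomial.eval_sub, Polynomial.eval_mul, Polynomial.eval_X,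
        Polynomial.eval_ofNat, Polynomial.eval_one, Polynomial.derivative_sub,
        Polynomial.derivative_one, Polynomial.derivative_mul, Polynomial.derivative_pow,
        Polynomial.derivative_X, Polynomial.derivative_ofNat,
        Polynomial.eval_pow, Polynomial.eval_add, Polynomial.eval_zero, Polynomial.eval_C,
        Pi.pow_apply, Pi.neg_apply, Function.comp, Pi.mul_apply]
      field_simp
      push_cast
      ring
    · obtain ⟨C, hC0, hC⟩ := exists_abs_eval_mul_exp_neg_sq_le (Polynomial.X ^ 4)
      have hM0 : 0 ≤ M := (abs_nonneg _).trans (hM 0)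
      have hlim : Filter.Tendsto (fun s : ℝ => 2 * C * M / z ^ 3 * s⁻¹) Filter.atTop (nhds 0) := by
        have h9 : Filter.Tendsto (fun s : ℝ => 2 * C * M / z ^ 3 * s⁻¹) Filter.atTop
            (nhds (2 * C * M / z ^ 3 * (0:ℝ))) := tendsto_inv_atTop_zero.const_mul _
        rwa [mul_zero] at h9
      refine squeeze_zero_norm' ?_ hlim
      filter_upwards [Filter.eventually_gt_atTop 0] with s hs
      have h1 := hC (z * s)
      have h2 : Real.exp (-(z * s) ^ 2 / 2) ≤ 1 := Real.exp_le_one_iff.mpr (by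
        have := sq_nonneg (z * s)
        linarith)
      have h3 : |(Polynomial.X ^ 4 : Polynomial ℝ).eval (z * s)| = (z * s) ^ 4 := by
        simp only [Polynomial.eval_pow, Polynomial.eval_X]
        exact abs_of_nonneg (by positivity)
      rw [h3] at h1
      have h4 : (z * s) ^ 4 * Real.exp (-(z * s) ^ 2) ≤ C := h1.trans (by nlinarith)
      rw [Real.norm_eq_abs, abs_mul, abs_of_pos (by positivity)]
      calc 2 * z * s ^ 3 * Real.exp (-(z * s) ^ 2) * |g (t - 1 / (4 * s ^ 2))|
          ≤ 2 * z * s ^ 3 * Real.exp (-(z * s) ^ 2) * M := by gcongr; exact hM _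
        _ = 2 * M / z ^ 3 * s⁻¹ * ((z * s) ^ 4 * Real.exp (-(z * s) ^ 2)) := by field_simp
        _ ≤ 2 * M / z ^ 3 * s⁻¹ * C := by gcongr
        _ = _ := by ring
  have h6 : ∫ s in Set.Ioi (0:ℝ), (z * (s ^ 0 * ((1 : Polynomial ℝ).eval (z * s) *
      Real.exp (-(z * s) ^ 2)) * g' (t - 1 / (4 * s ^ 2))) -
      s ^ 1 * ((gaussDerivative (1 - 2 * Polynomial.X ^ 2)).eval (z * s) *
      Real.exp (-(z * s) ^ 2)) * g (t - 1 / (4 * s ^ 2))) = _ := integral_sub i1 i2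
  rw [h6, integral_const_mul] at h0
  rw [selfSimilarIntegral, selfSimilarIntegral, h0]
  simp

end

lemma IsLocalMax.second_deriv_nonpos {f f' : ℝ → ℝ} {f'' x : ℝ} (hmax : IsLocalMax f x)
    (hf : ∀ᶠ y in nhds x, HasDerivAt f (f' y) y) (hf' : HasDerivAt f' f'' x) : f'' ≤ 0 := by
  by_contra! hpos
  have h1 : deriv f =ᶠ[nhds x] f' := hf.mono fun y hy => hy.deriv
  have h2 : deriv (deriv f) x = f'' := by rw [h1.deriv_eq, hf'.deriv]
  have hmin : IsLocalMin f x := isLocalMin_of_deriv_deriv_pos (by rwa [h2]) hmax.deriv_eq_zero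
    hf.self_of_nhds.continuousAt
  have h3 : f =ᶠ[nhds x] fun _ => f x := by
    filter_upwards [hmax, hmin] with y hy hy'
    exact le_antisymm hy hy'
  have h4 : deriv f =ᶠ[nhds x] fun _ => 0 := by
    filter_upwards [h3.eventuallyEq_nhds] with y hy
    rw [hy.deriv_eq, deriv_const]
  rw [h4.deriv_eq, deriv_const] at h2
  linarith

lemma deriv_nonneg_of_le_on_left {f : ℝ → ℝ} {a t : ℝ} (ht : 0 < t) (hf : HasDerivAt f a t)
    (hmax : ∀ s ∈ Set.Icc 0 t, f s ≤ f t) : 0 ≤ a := by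
  have h1 := (hasDerivAt_iff_tendsto_slope_left_right.mp hf).1
  refine ge_of_tendsto h1 ?_
  filter_upwards [Ioo_mem_nhdsLT ht] with s hs
  rw [slope_def_field]
  exact div_nonneg_of_nonpos (by linarith [hmax s ⟨hs.1.le, hs.2.le⟩]) (by linarith [hs.2])

/-- Classical solutions on `[-1,1]` of a heat equation with homogeneous Dirichlet conditions, zero
initial data and forcing smaller than `F`. -/
structure IsForcedHeatSolution (ε F : ℝ) (W Wt Wy Wyy : ℝ → ℝ → ℝ) : Prop where
  cont : ContinuousOn (uncurry W) (Set.Ici (0:ℝ) ×ˢ Set.Icc (-1:ℝ) 1)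
  deriv_time : ∀ t > (0:ℝ), ∀ y ∈ Set.Ioo (-1:ℝ) 1, HasDerivAt (fun τ => W τ y) (Wt t y) t
  deriv_space : ∀ t > (0:ℝ), ∀ y ∈ Set.Ioo (-1:ℝ) 1, HasDerivAt (W t) (Wy t y) y
  deriv_space_two : ∀ t > (0:ℝ), ∀ y ∈ Set.Ioo (-1:ℝ) 1, HasDerivAt (Wy t) (Wyy t y) y
  forcing : ∀ t > (0:ℝ), ∀ y ∈ Set.Ioo (-1:ℝ) 1, |Wt t y - ε * Wyy t y| < F
  left : ∀ t ≥ (0:ℝ), W t (-1) = 0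
  right : ∀ t ≥ (0:ℝ), W t 1 = 0
  at_zero : ∀ y ∈ Set.Icc (-1:ℝ) 1, W 0 y = 0

namespace IsForcedHeatSolution

variable {ε F : ℝ} {W Wt Wy Wyy : ℝ → ℝ → ℝ}

lemma neg (hW : IsForcedHeatSolution ε F W Wt Wy Wyy) :
    IsForcedHeatSolution ε F (fun t y => -W t y) (fun t y => -Wt t y) (fun t y => -Wy t y)
      (fun t y => -Wyy t y) where
  cont := hW.cont.neg
  deriv_time t ht y hy := (hW.deriv_time t ht y hy).neg
  deriv_space t ht y hy := (hW.deriv_space t ht y hy).neg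
  deriv_space_two t ht y hy := (hW.deriv_space_two t ht y hy).neg
  forcing t ht y hy := by
    have := hW.forcing t ht y hy
    rwa [show -Wt t y - ε * -Wyy t y = -(Wt t y - ε * Wyy t y) by ring, abs_neg]
  left t ht := by simp [hW.left t ht]
  right t ht := by simp [hW.right t ht]
  at_zero y hy := by simp [hW.at_zero y hy]

lemma forcing_pos (hW : IsForcedHeatSolution ε F W Wt Wy Wyy) : 0 < F :=
  (abs_nonneg _).trans_lt (hW.forcing 1 one_pos 0 ⟨by norm_num, by norm_num⟩)

lemma le_barrier (hW : IsForcedHeatSolution ε F W Wt Wy Wyy) (hε : 0 < ε) {t y : ℝ} (ht : 0 ≤ t)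
    (hy : y ∈ Set.Icc (-1:ℝ) 1) : W t y ≤ F / (2 * ε) * (1 - y ^ 2) := by
  have hF := hW.forcing_pos
  set A := F / (2 * ε) with hA
  have hA0 : 0 < A := by positivity
  have hAF : ε * (2 * A) = F := by rw [hA]; field_simp
  set G : ℝ × ℝ → ℝ := fun q => uncurry W q - A * (1 - q.2 ^ 2) with hG
  obtain ⟨⟨s, x⟩, ⟨hs, hx⟩, hmax⟩ := (isCompact_Icc.prod isCompact_Icc :
    IsCompact (Set.Icc 0 t ×ˢ Set.Icc (-1:ℝ) 1)).exists_isMaxOn ⟨(t, y), ⟨ht, le_rfl⟩, hy⟩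
    (f := G) ((hW.cont.mono (Set.prod_mono (fun a ha => ha.1) le_rfl)).sub
      (by fun_prop : Continuous fun q : ℝ × ℝ => A * (1 - q.2 ^ 2)).continuousOn)
  have hle : ∀ a ∈ Set.Icc 0 t, ∀ b ∈ Set.Icc (-1:ℝ) 1,
      W a b - A * (1 - b ^ 2) ≤ W s x - A * (1 - x ^ 2) := fun a ha b hb => hmax (a := (a, b)) ⟨ha, hb⟩
  suffices W s x - A * (1 - x ^ 2) ≤ 0 by linarith [hle t ⟨ht, le_rfl⟩ y hy]
  simp only at hs hx
  rcases hs.1.eq_or_lt with h0 | h0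
  · subst h0
    rw [hW.at_zero x hx]
    nlinarith [hx.1, hx.2, mul_nonneg hA0.le (mul_nonneg (sub_nonneg.2 hx.1) (sub_nonneg.2 hx.2))]
  rcases hx.1.eq_or_lt with h1 | h1
  · subst h1
    rw [hW.left s hs.1]; norm_num
  rcases hx.2.eq_or_lt with h2 | h2
  · subst h2
    rw [hW.right s hs.1]; norm_num
  exfalso
  have hx' : x ∈ Set.Ioo (-1:ℝ) 1 := ⟨h1, h2⟩
  have htime : 0 ≤ Wt s x := deriv_nonneg_of_le_on_left h0 (hW.deriv_time s h0 x hx')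
    fun a ha => by linarith [hle a ⟨ha.1, ha.2.trans hs.2⟩ x hx]
  have hspace : Wyy s x + 2 * A ≤ 0 := by
    refine IsLocalMax.second_deriv_nonpos (f := fun b => W s b - A * (1 - b ^ 2))
      (f' := fun b => Wy s b + 2 * A * b) (x := x) ?_ ?_ ?_
    · filter_upwards [Ioo_mem_nhds h1 h2] with b hb
      exact hle s hs b ⟨hb.1.le, hb.2.le⟩
    · filter_upwards [Ioo_mem_nhds h1 h2] with b hb
      refine ((hW.deriv_space s h0 b hb).sub
        (((hasDerivAt_pow 2 b).const_sub 1).const_mul A)).congr_deriv ?_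
      push_cast
      ring
    · exact ((hW.deriv_space_two s h0 x hx').add
        ((hasDerivAt_id x).const_mul (2 * A))).congr_deriv (by ring)
  have hf := (abs_lt.mp (hW.forcing s h0 x hx')).2
  have := mul_le_mul_of_nonneg_left hspace hε.le
  linarith

lemma sub_le (hW : IsForcedHeatSolution ε F W Wt Wy Wyy) (hε : 0 < ε) {t x y : ℝ} (ht : 0 ≤ t)
    (hy : -1 ≤ y) (hyx : y ≤ x) (hx : x ≤ 1) :
    W t x - W t y ≤ F / (2 * ε) * (4 * (x - y) - (x - y) ^ 2) := by
  have hF := hW.forcing_pos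
  have hup := fun s b (hs : 0 ≤ s) hb => hW.le_barrier hε (t := s) (y := b) hs hb
  have hlow := fun s b (hs : 0 ≤ s) hb => hW.neg.le_barrier hε (t := s) (y := b) hs hb
  set A := F / (2 * ε) with hA
  have hA0 : 0 < A := by positivity
  have hAF : ε * (2 * A) = F := by rw [hA]; field_simp
  set K : Set (ℝ × ℝ × ℝ) :=
    (Set.Icc 0 t ×ˢ (Set.Icc (-1:ℝ) 1 ×ˢ Set.Icc (-1:ℝ) 1)) ∩ {q | q.2.2 ≤ q.2.1} with hK
  have hKc : IsCompact K := (isCompact_Icc.prod (isCompact_Icc.prod isCompact_Icc)).inter_right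
    (isClosed_le (by fun_prop) (by fun_prop))
  set G : ℝ × ℝ × ℝ → ℝ := fun q => uncurry W (q.1, q.2.1) - uncurry W (q.1, q.2.2) -
    A * (4 * (q.2.1 - q.2.2) - (q.2.1 - q.2.2) ^ 2) with hG
  have hGc : ContinuousOn G K := by
    refine ((hW.cont.comp (f := fun q : ℝ × ℝ × ℝ => (q.1, q.2.1)) (by fun_prop) ?_).sub
      (hW.cont.comp (f := fun q : ℝ × ℝ × ℝ => (q.1, q.2.2)) (by fun_prop) ?_)).sub
      (by fun_prop)
    · exact fun q hq => ⟨hq.1.1.1, hq.1.2.1⟩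
    · exact fun q hq => ⟨hq.1.1.1, hq.1.2.2⟩
  obtain ⟨⟨s, a, b⟩, ⟨⟨hs, ha, hb⟩, hba⟩, hmax⟩ := hKc.exists_isMaxOn
    ⟨(t, x, y), ⟨⟨⟨ht, le_rfl⟩, ⟨hy.trans hyx, hx⟩, ⟨hy, hyx.trans hx⟩⟩, hyx⟩⟩ hGc
  have hle : ∀ s' ∈ Set.Icc 0 t, ∀ a' ∈ Set.Icc (-1:ℝ) 1, ∀ b' ∈ Set.Icc (-1:ℝ) 1, b' ≤ a' →
      W s' a' - W s' b' - A * (4 * (a' - b') - (a' - b') ^ 2) ≤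
        W s a - W s b - A * (4 * (a - b) - (a - b) ^ 2) :=
    fun s' hs' a' ha' b' hb' h' => hmax (a := (s', a', b')) ⟨⟨hs', ha', hb'⟩, h'⟩
  suffices W s a - W s b - A * (4 * (a - b) - (a - b) ^ 2) ≤ 0 by
    linarith [hle t ⟨ht, le_rfl⟩ x ⟨hy.trans hyx, hx⟩ y ⟨hy, hyx.trans hx⟩ hyx]
  simp only [Set.mem_ofPred_eq] at hs ha hb hba
  have hψ : ∀ r : ℝ, 0 ≤ r → r ≤ 2 → 0 ≤ A * (4 * r - r ^ 2) := fun r h0 h2 =>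
    mul_nonneg hA0.le (by nlinarith)
  rcases hs.1.eq_or_lt with h0 | h0
  · subst h0
    rw [hW.at_zero a ha, hW.at_zero b hb]
    linarith [hψ (a - b) (by linarith) (by linarith [ha.2, hb.1])]
  rcases hba.eq_or_lt with hab | hab
  · subst hab
    simp
  rcases hb.1.eq_or_lt with h1 | h1
  · subst h1
    rw [hW.left s hs.1]
    nlinarith [hup s a hs.1 ha, mul_nonneg hA0.le (sub_nonneg.2 ha.1)]
  rcases ha.2.eq_or_lt with h2 | h2
  · subst h2
    rw [hW.right s hs.1]
    nlinarith [hlow s b hs.1 hb, mul_nonneg hA0.le (sub_nonneg.2 hb.2)]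
  exfalso
  have ha' : a ∈ Set.Ioo (-1:ℝ) 1 := ⟨by linarith, h2⟩
  have hb' : b ∈ Set.Ioo (-1:ℝ) 1 := ⟨h1, by linarith⟩
  have htime : 0 ≤ Wt s a - Wt s b := deriv_nonneg_of_le_on_left h0
    ((hW.deriv_time s h0 a ha').sub (hW.deriv_time s h0 b hb')) fun s' hs' => by
      have := hle s' ⟨hs'.1, hs'.2.trans hs.2⟩ a ha b hb hba
      simp only [Pi.sub_apply]
      linarith
  have hspace_a : Wyy s a + 2 * A ≤ 0 := by
    refine IsLocalMax.second_deriv_nonpos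
      (f := fun c => W s c - W s b - A * (4 * (c - b) - (c - b) ^ 2))
      (f' := fun c => Wy s c - A * (4 - 2 * (c - b))) (x := a) ?_ ?_ ?_
    · filter_upwards [Ioo_mem_nhds hab h2] with c hc
      exact hle s hs c ⟨by linarith [hc.1], hc.2.le⟩ b hb hc.1.le
    · filter_upwards [Ioo_mem_nhds hab h2] with c hc
      have h5 := (hasDerivAt_id c).sub_const b
      refine (((hW.deriv_space s h0 c ⟨by linarith [hc.1], hc.2⟩).sub_const (W s b)).sub
        (((h5.const_mul 4).sub (h5.pow 2)).const_mul A)).congr_deriv ?_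
      simp only [id]
      push_cast
      ring
    · have h5 := (hasDerivAt_id a).sub_const b
      refine ((hW.deriv_space_two s h0 a ha').sub
        (((h5.const_mul 2).const_sub 4).const_mul A)).congr_deriv ?_
      ring
  have hspace_b : -Wyy s b + 2 * A ≤ 0 := by
    refine IsLocalMax.second_deriv_nonpos
      (f := fun c => W s a - W s c - A * (4 * (a - c) - (a - c) ^ 2))
      (f' := fun c => -Wy s c + A * (4 - 2 * (a - c))) (x := b) ?_ ?_ ?_
    · filter_upwards [Ioo_mem_nhds h1 hab] with c hc
      exact hle s hs a ha c ⟨hc.1.le, by linarith [hc.2]⟩ hc.2.le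
    · filter_upwards [Ioo_mem_nhds h1 hab] with c hc
      have h5 := (hasDerivAt_id c).const_sub a
      refine (((hW.deriv_space s h0 c ⟨hc.1, by linarith [hc.2]⟩).const_sub (W s a)).sub
        (((h5.const_mul 4).sub (h5.pow 2)).const_mul A)).congr_deriv ?_
      simp only [id]
      push_cast
      ring
    · have h5 := (hasDerivAt_id b).const_sub a
      refine ((hW.deriv_space_two s h0 b hb').neg.add
        (((h5.const_mul 2).const_sub 4).const_mul A)).congr_deriv ?_
      ring
  have hfa := (abs_lt.mp (hW.forcing s h0 a ha')).2
  have hfb := (abs_lt.mp (hW.forcing s h0 b hb')).1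
  have h6 := mul_le_mul_of_nonneg_left hspace_a hε.le
  have h7 := mul_le_mul_of_nonneg_left hspace_b hε.le
  linarith

lemma abs_le (hW : IsForcedHeatSolution ε F W Wt Wy Wyy) (hε : 0 < ε) {t y : ℝ} (ht : 0 ≤ t)
    (hy : y ∈ Set.Icc (-1:ℝ) 1) : |W t y| ≤ F / ε := by
  have hF := hW.forcing_pos
  have h1 : F / (2 * ε) * (1 - y ^ 2) ≤ F / ε := by
    rw [div_mul_eq_mul_div, div_le_div_iff₀ (by positivity) hε]
    nlinarith [mul_pos hF hε, mul_nonneg (mul_pos hF hε).le (sq_nonneg y)]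
  rw [_root_.abs_le]
  constructor <;> linarith [hW.le_barrier hε ht hy, hW.neg.le_barrier hε ht hy]

lemma abs_sub_le (hW : IsForcedHeatSolution ε F W Wt Wy Wyy) (hε : 0 < ε) {t x y : ℝ} (ht : 0 ≤ t)
    (hx : x ∈ Set.Icc (-1:ℝ) 1) (hy : y ∈ Set.Icc (-1:ℝ) 1) :
    |W t x - W t y| ≤ 2 * F / ε * |x - y| := by
  wlog hyx : y ≤ x generalizing x y
  · rw [abs_sub_comm, abs_sub_comm x]
    exact this hy hx (le_of_not_ge hyx)
  have hF := hW.forcing_pos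
  have h1 : F / (2 * ε) * (4 * (x - y) - (x - y) ^ 2) ≤ 2 * F / ε * (x - y) := by
    have : 2 * F / ε * (x - y) = F / (2 * ε) * (4 * (x - y)) := by field_simp; ring
    rw [this]
    gcongr
    linarith [sq_nonneg (x - y)]
  rw [abs_of_nonneg (sub_nonneg.2 hyx), _root_.abs_le]
  constructor <;> linarith [hW.sub_le hε ht hy.1 hyx hx.2, hW.neg.sub_le hε ht hy.1 hyx hx.2]

end IsForcedHeatSolution

lemma abs_deriv_le_of_lipschitz_Icc {f : ℝ → ℝ} {L y : ℝ} (hL : 0 ≤ L)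
    (hf : ∀ x ∈ Set.Icc (-1:ℝ) 1, |f x - f y| ≤ L * |x - y|) (hy : y ∈ Set.Icc (-1:ℝ) 1) :
    |deriv f y| ≤ L := by
  by_cases hd : DifferentiableAt ℝ f y
  · have hlim : Filter.Tendsto (slope f y) (nhdsWithin y (Set.Icc (-1:ℝ) 1 \ {y}))
        (nhds (deriv f y)) := hasDerivWithinAt_iff_tendsto_slope.mp hd.hasDerivAt.hasDerivWithinAt
    have hne : (nhdsWithin y (Set.Icc (-1:ℝ) 1 \ {y})).NeBot := by
      have := (uniqueDiffOn_Icc (show (-1:ℝ) < 1 by norm_num)) y hy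
      exact accPt_principal_iff_nhdsWithin.mp this.accPt
    refine le_of_tendsto hlim.abs ?_
    filter_upwards [self_mem_nhdsWithin] with x hx
    have hxy : 0 < |x - y| := abs_pos.mpr (sub_ne_zero.mpr hx.2)
    rw [slope_def_field, abs_div, div_le_iff₀ hxy]
    exact hf x hx.1
  · rw [deriv_zero_of_not_differentiableAt hd, abs_zero]
    exact hL

lemma quarterPlane_heat_nonpos {D Dt Dz Dzz : ℝ → ℝ → ℝ} {M : ℝ}
    (hbdd : ∀ t ≥ (0:ℝ), ∀ z ≥ (0:ℝ), D t z ≤ M)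
    (hcont : ContinuousOn (uncurry D) (Set.Ici (0:ℝ) ×ˢ Set.Ici (0:ℝ)))
    (hDt : ∀ t > (0:ℝ), ∀ z > (0:ℝ), HasDerivAt (fun τ => D τ z) (Dt t z) t)
    (hDz : ∀ t > (0:ℝ), ∀ z > (0:ℝ), HasDerivAt (D t) (Dz t z) z)
    (hDzz : ∀ t > (0:ℝ), ∀ z > (0:ℝ), HasDerivAt (Dz t) (Dzz t z) z)
    (hheat : ∀ t > (0:ℝ), ∀ z > (0:ℝ), Dt t z = Dzz t z)
    (hinit : ∀ z ≥ (0:ℝ), D 0 z = 0) (hleft : ∀ t ≥ (0:ℝ), D t 0 = 0)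
    {t z : ℝ} (ht : 0 ≤ t) (hz : 0 ≤ z) : D t z ≤ 0 := by
  have key : ∀ δ > (0:ℝ), D t z ≤ δ * (z ^ 2 + 3 * t) := by
    intro δ hδ
    have hM0 : 0 ≤ M := by simpa [hinit 0 le_rfl] using hbdd 0 le_rfl 0 le_rfl
    set R : ℝ := z + 1 + M / δ with hR
    have hMδ : 0 ≤ M / δ := by positivity
    have hR1 : 1 ≤ R := by linarith
    have hRM : M ≤ δ * R ^ 2 := by
      have h1 : M = δ * (M / δ) := by field_simp
      rw [h1]
      gcongr
      nlinarith
    obtain ⟨⟨s, x⟩, ⟨hs, hx⟩, hmax⟩ := (isCompact_Icc.prod isCompact_Icc :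
      IsCompact (Set.Icc 0 t ×ˢ Set.Icc 0 R)).exists_isMaxOn
      ⟨(t, z), ⟨ht, le_rfl⟩, ⟨hz, by linarith⟩⟩
      (f := fun q => uncurry D q - δ * (q.2 ^ 2 + 3 * q.1))
      ((hcont.mono (Set.prod_mono (fun a ha => ha.1) (fun a ha => ha.1))).sub
        (by fun_prop : Continuous fun q : ℝ × ℝ => δ * (q.2 ^ 2 + 3 * q.1)).continuousOn)
    have hle : ∀ a ∈ Set.Icc 0 t, ∀ b ∈ Set.Icc 0 R,
        D a b - δ * (b ^ 2 + 3 * a) ≤ D s x - δ * (x ^ 2 + 3 * s) :=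
      fun a ha b hb => hmax (a := (a, b)) ⟨ha, hb⟩
    suffices D s x - δ * (x ^ 2 + 3 * s) ≤ 0 by
      linarith [hle t ⟨ht, le_rfl⟩ z ⟨hz, by linarith⟩]
    simp only at hs hx
    have hs0 : 0 ≤ δ * (x ^ 2 + 3 * s) := mul_nonneg hδ.le (by nlinarith [hs.1])
    rcases hs.1.eq_or_lt with h0 | h0
    · subst h0
      rw [hinit x hx.1]
      linarith
    rcases hx.1.eq_or_lt with h1 | h1
    · subst h1
      rw [hleft s hs.1]
      linarith
    rcases hx.2.eq_or_lt with h2 | h2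
    · rw [h2]
      have := hbdd s hs.1 R (by linarith)
      nlinarith [mul_pos hδ h0]
    exfalso
    have htime : 0 ≤ Dt s x - δ * 3 := by
      refine deriv_nonneg_of_le_on_left (f := fun a => D a x - δ * (x ^ 2 + 3 * a)) h0
        ((hDt s h0 x h1).sub ?_) fun a ha => hle a ⟨ha.1, ha.2.trans hs.2⟩ x hx
      simpa using (((hasDerivAt_id s).const_mul 3).const_add (x ^ 2)).const_mul δ
    have hspace : Dzz s x - δ * 2 ≤ 0 := by
      refine IsLocalMax.second_deriv_nonpos (f := fun b => D s b - δ * (b ^ 2 + 3 * s))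
        (f' := fun b => Dz s b - δ * (2 * b)) (x := x) ?_ ?_ ?_
      · filter_upwards [Ioo_mem_nhds h1 h2] with b hb
        exact hle s hs b ⟨hb.1.le, hb.2.le⟩
      · filter_upwards [Ioo_mem_nhds h1 h2] with b hb
        refine ((hDz s h0 b hb.1).sub
          (((hasDerivAt_pow 2 b).add_const (3 * s)).const_mul δ)).congr_deriv ?_
        push_cast
        ring
      · exact ((hDzz s h0 x h1).sub
          (((hasDerivAt_id x).const_mul 2).const_mul δ)).congr_deriv (by ring)
    rw [hheat s h0 x h1] at htime
    linarith
  refine le_of_forall_pos_le_add fun η hη => ?_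
  have hpos : 0 < z ^ 2 + 3 * t + 1 := by positivity
  have := key (η / (z ^ 2 + 3 * t + 1)) (by positivity)
  have h2 : η / (z ^ 2 + 3 * t + 1) * (z ^ 2 + 3 * t) ≤ η := by
    rw [div_mul_eq_mul_div, div_le_iff₀ hpos]
    nlinarith
  linarith

lemma exists_abs_le_of_eq_zero_off_Ioo {f : ℝ → ℝ} {T : ℝ} (hf : Continuous f)
    (h0 : ∀ t ∉ Set.Ioo 0 T, f t = 0) : ∃ M, ∀ t, |f t| ≤ M := by
  obtain ⟨M, hM⟩ := isCompact_Icc.exists_bound_of_continuousOn (s := Set.Icc 0 T) hf.continuousOn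
  refine ⟨max M 0, fun t => ?_⟩
  by_cases ht : t ∈ Set.Ioo 0 T
  · exact (hM t ⟨ht.1.le, ht.2.le⟩).trans (le_max_left _ _)
  · simp [h0 t ht]

lemma primitive_eq_zero_off_Ioo {f : ℝ → ℝ} {T : ℝ} (hf : Continuous f)
    (h0 : ∀ t ∉ Set.Ioo 0 T, f t = 0) (hint : ∫ t in (0:ℝ)..T, f t = 0) :
    ∀ t ∉ Set.Ioo 0 T, ∫ s in (0:ℝ)..t, f s = 0 := by
  intro t ht
  rcases le_or_gt t 0 with h1 | h1
  · rw [intervalIntegral.integral_congr (g := fun _ => 0), intervalIntegral.integral_zero]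
    intro s hs
    rw [Set.uIcc_of_ge h1] at hs
    exact h0 s fun h => by linarith [h.1, hs.2]
  · have h2 : T ≤ t := by
      by_contra! h
      exact ht ⟨h1, h⟩
    rw [← intervalIntegral.integral_add_adjacent_intervals (hf.intervalIntegrable 0 T)
      (hf.intervalIntegrable T t), hint, zero_add,
      intervalIntegral.integral_congr (g := fun _ => 0), intervalIntegral.integral_zero]
    intro s hs
    rw [Set.uIcc_of_le h2] at hs
    exact h0 s fun h => by linarith [h.2, hs.1]

lemma exists_bounded_second_primitive {h : ℝ → ℝ} {T : ℝ} (hc : Continuous h)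
    (h0 : ∀ t ∉ Set.Ioo 0 T, h t = 0) (hm0 : ∫ t in (0:ℝ)..T, h t = 0)
    (hm1 : ∫ t in (0:ℝ)..T, t * h t = 0) :
    ∃ g₁ g₂ : ℝ → ℝ, (∀ t, HasDerivAt g₁ (h t) t) ∧ (∀ t, HasDerivAt g₂ (g₁ t) t) ∧
      (∃ M, ∀ t, |g₁ t| ≤ M) ∧ ∃ M, ∀ t, |g₂ t| ≤ M := by
  have hc1 : Continuous fun t => t * h t := continuous_id.mul hc
  have hd0 : ∀ t, HasDerivAt (fun t => ∫ s in (0:ℝ)..t, h s) (h t) t := fun t =>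
    hc.integral_hasStrictDerivAt 0 t |>.hasDerivAt
  have hd1 : ∀ t, HasDerivAt (fun t => ∫ s in (0:ℝ)..t, s * h s) (t * h t) t := fun t =>
    hc1.integral_hasStrictDerivAt 0 t |>.hasDerivAt
  have hz0 := primitive_eq_zero_off_Ioo hc h0 hm0
  have hz1 := primitive_eq_zero_off_Ioo hc1 (fun t ht => by simp [h0 t ht]) hm1
  have hd2 : ∀ t, HasDerivAt (fun t => t * (∫ s in (0:ℝ)..t, h s) - ∫ s in (0:ℝ)..t, s * h s)
      (∫ s in (0:ℝ)..t, h s) t := fun t =>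
    (((hasDerivAt_id t).mul (hd0 t)).sub (hd1 t)).congr_deriv (by simp)
  refine ⟨_, _, hd0, hd2, exists_abs_le_of_eq_zero_off_Ioo
    (continuous_iff_continuousAt.mpr fun t => (hd0 t).continuousAt) hz0,
    exists_abs_le_of_eq_zero_off_Ioo (T := T)
    (continuous_iff_continuousAt.mpr fun t => (hd2 t).continuousAt) fun t ht => ?_⟩
  rw [hz0 t ht, hz1 t ht]
  ring

lemma exists_boundaryHeat_decay {h g₁ g₂ : ℝ → ℝ} {M₀ M₁ M₂ : ℝ} (hc : Continuous h)
    (hg₁ : ∀ t, HasDerivAt g₁ (h t) t) (hg₂ : ∀ t, HasDerivAt g₂ (g₁ t) t)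
    (hM₀ : ∀ t, |h t| ≤ M₀) (hM₁ : ∀ t, |g₁ t| ≤ M₁) (hM₂ : ∀ t, |g₂ t| ≤ M₂) :
    ∃ C ≥ (0:ℝ), ∀ t, ∀ z > (0:ℝ),
      |boundaryHeat h t z| ≤ C / z ^ 4 ∧ |deriv (boundaryHeat h t) z| ≤ C / z ^ 5 := by
  have hc₁ : Continuous g₁ := continuous_iff_continuousAt.mpr fun x => (hg₁ x).continuousAt
  have hc₂ : Continuous g₂ := continuous_iff_continuousAt.mpr fun x => (hg₂ x).continuousAt
  set c : ℝ := 2 / Real.sqrt Real.pi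
  set p : Polynomial ℝ := 1 - 2 * Polynomial.X ^ 2
  set q := gaussDerivative p
  set q₂ := gaussDerivative q
  set q₃ := gaussDerivative q₂
  set q₄ := gaussDerivative q₃
  have hc0 : 0 < c := by positivity
  have e1 : ∀ t, ∀ z > (0:ℝ), boundaryHeat h t z = c * selfSimilarIntegral q 1 g₁ t z :=
    fun t z hz => boundaryHeat_deriv_eq hg₁ hc hM₁ hM₀ t hz
  have e2 : ∀ t, ∀ z > (0:ℝ), boundaryHeat g₁ t z = c * selfSimilarIntegral q 1 g₂ t z :=
    fun t z hz => boundaryHeat_deriv_eq hg₂ hc₁ hM₂ hM₁ t hz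
  have e3 : ∀ t, ∀ z > (0:ℝ),
      c * selfSimilarIntegral p 0 g₁ t z = c * selfSimilarIntegral q₂ 2 g₂ t z := by
    intro t z hz
    refine (hasDerivAt_boundaryHeat_space hc₁ hM₁ t hz).unique
      (((hasDerivAt_selfSimilarIntegral_space hc₂ hM₂ q 1 t hz).const_mul c).congr_of_eventuallyEq ?_)
    filter_upwards [Ioi_mem_nhds hz] with w hw using e2 t w hw
  have e4 : ∀ t, ∀ z > (0:ℝ), boundaryHeat h t z = c * selfSimilarIntegral q₃ 3 g₂ t z := by
    intro t z hz
    rw [e1 t z hz]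
    refine ((hasDerivAt_selfSimilarIntegral_space hc₁ hM₁ p 0 t hz).const_mul c).unique
      (((hasDerivAt_selfSimilarIntegral_space hc₂ hM₂ q₂ 2 t hz).const_mul c).congr_of_eventuallyEq
        ?_)
    filter_upwards [Ioi_mem_nhds hz] with w hw using e3 t w hw
  have e5 : ∀ t, ∀ z > (0:ℝ),
      deriv (boundaryHeat h t) z = c * selfSimilarIntegral q₄ 4 g₂ t z := by
    intro t z hz
    refine HasDerivAt.deriv
      (((hasDerivAt_selfSimilarIntegral_space hc₂ hM₂ q₃ 3 t hz).const_mul c).congr_of_eventuallyEq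
        ?_)
    filter_upwards [Ioi_mem_nhds hz] with w hw using e4 t w hw
  obtain ⟨C₃, h₃0, h₃⟩ := exists_abs_selfSimilarIntegral_le hM₂ q₃ 3
  obtain ⟨C₄, h₄0, h₄⟩ := exists_abs_selfSimilarIntegral_le hM₂ q₄ 4
  refine ⟨c * (C₃ + C₄), by positivity, fun t z hz => ⟨?_, ?_⟩⟩
  · rw [e4 t z hz, abs_mul, abs_of_pos hc0, mul_div_assoc]
    gcongr
    exact (h₃ t z hz).trans (by gcongr; linarith)
  · rw [e5 t z hz, abs_mul, abs_of_pos hc0, mul_div_assoc]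
    gcongr
    exact (h₄ t z hz).trans (by gcongr; linarith)

lemma ContDiffAt.hasDerivAt_deriv_two {f : ℝ → ℝ} {x : ℝ} (hf : ContDiffAt ℝ (⊤ : ℕ∞) f x) :
    HasDerivAt f (deriv f x) x ∧ HasDerivAt (deriv f) (iteratedDeriv 2 f x) x := by
  refine ⟨(hf.differentiableAt (by simp)).hasDerivAt, ?_⟩
  have h1 : DifferentiableAt ℝ (deriv f) x :=
    ((hf.fderiv_right (m := 1) (WithTop.coe_le_coe.mpr (le_top : (1 + 1 : ℕ∞) ≤ ⊤))).differentiableAt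
      (by simp)).clm_apply (differentiableAt_const 1)
  rw [iteratedDeriv_succ, iteratedDeriv_one]
  exact h1.hasDerivAt

lemma eq_boundaryHeat {h : ℝ → ℝ} {M : ℝ} (hsmooth : ContDiff ℝ (⊤ : ℕ∞) h)
    {M₀ M₁ : ℝ} (hM₀ : ∀ t, |h t| ≤ M₀) (hM₁ : ∀ t, |deriv h t| ≤ M₁)
    (h0 : ∀ t ≤ 0, h t = 0) {V : ℝ → ℝ → ℝ}
    (hVbdd : ∀ t ≥ (0:ℝ), ∀ z ≥ (0:ℝ), |V t z| ≤ M)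
    (hVcont : ContinuousOn (fun p : ℝ × ℝ => V p.1 p.2) (Set.Ici (0:ℝ) ×ˢ Set.Ici (0:ℝ)))
    (hVsmooth : ContDiffOn ℝ (⊤ : ℕ∞) (fun p : ℝ × ℝ => V p.1 p.2)
      (Set.Ioi (0:ℝ) ×ˢ Set.Ici (0:ℝ)))
    (hheat : ∀ t > (0:ℝ), ∀ z > (0:ℝ), deriv (fun τ => V τ z) t = iteratedDeriv 2 (V t) z)
    (hbc : ∀ t ≥ (0:ℝ), V t 0 = h t) (hic : ∀ z ≥ (0:ℝ), V 0 z = 0)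
    {t z : ℝ} (ht : 0 ≤ t) (hz : 0 ≤ z) : V t z = boundaryHeat h t z := by
  have hc := hsmooth.continuous
  have hc' : Continuous (deriv h) := hsmooth.continuous_deriv (by simp)
  have hd : ∀ x, HasDerivAt h (deriv h x) x := fun x =>
    (hsmooth.differentiable (by simp) x).hasDerivAt
  have hVat : ∀ t > (0:ℝ), ∀ z > (0:ℝ),
      ContDiffAt ℝ (⊤ : ℕ∞) (fun p : ℝ × ℝ => V p.1 p.2) (t, z) := fun t ht z hz =>
    hVsmooth.contDiffAt (prod_mem_nhds (Ioi_mem_nhds ht) (Ici_mem_nhds hz))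
  have hVz : ∀ t > (0:ℝ), ∀ z > (0:ℝ), ContDiffAt ℝ (⊤ : ℕ∞) (V t) z := fun t ht z hz =>
    (hVat t ht z hz).comp (f := fun y : ℝ => (t, y)) z (by fun_prop)
  have hVt : ∀ t > (0:ℝ), ∀ z > (0:ℝ), ContDiffAt ℝ (⊤ : ℕ∞) (fun τ => V τ z) t :=
    fun t ht z hz => (hVat t ht z hz).comp (f := fun τ : ℝ => (τ, z)) t (by fun_prop)
  set c : ℝ := 2 / Real.sqrt Real.pi
  set p : Polynomial ℝ := 1 - 2 * Polynomial.X ^ 2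
  have hUt := fun t z => hasDerivAt_boundaryHeat_time hd hc' hM₀ hM₁ t z
  have hUz := fun t z (hz : 0 < z) => hasDerivAt_boundaryHeat_space hc hM₀ t hz
  have hUzz := fun t z (hz : 0 < z) =>
    (hasDerivAt_selfSimilarIntegral_space hc hM₀ p 0 t hz).const_mul c
  have hUheat := fun t z (hz : 0 < z) => boundaryHeat_deriv_eq hd hc' hM₀ hM₁ t hz
  have hUc := (continuous_boundaryHeat hc hM₀).continuousOn (s := Set.Ici (0:ℝ) ×ˢ Set.Ici (0:ℝ))
  have hUi : ∀ z, boundaryHeat h 0 z = 0 := by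
    intro z
    rw [boundaryHeat]
    have : ∀ u : ℝ, h (0 - z ^ 2 / (4 * u ^ 2)) = 0 := fun u => h0 _ (by
      have : 0 ≤ z ^ 2 / (4 * u ^ 2) := by positivity
      linarith)
    simp only [this, mul_zero, integral_zero]
  have hle : V t z - boundaryHeat h t z ≤ 0 := by
    refine quarterPlane_heat_nonpos (D := fun t z => V t z - boundaryHeat h t z) (M := M + M₀)
      (fun t ht z hz => ?_) (hVcont.sub hUc)
      (fun t ht z hz => (hVt t ht z hz).hasDerivAt_deriv_two.1.sub (hUt t z))
      (fun t ht z hz => (hVz t ht z hz).hasDerivAt_deriv_two.1.sub (hUz t z hz))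
      (fun t ht z hz => (hVz t ht z hz).hasDerivAt_deriv_two.2.sub (hUzz t z hz))
      (fun t ht z hz => by rw [hheat t ht z hz, hUheat t z hz])
      (fun z hz => by rw [hic z hz, hUi z, sub_zero])
      (fun t ht => by rw [hbc t ht, boundaryHeat_zero_right, sub_self]) ht hz
    linarith [(abs_le.mp (hVbdd t ht z hz)).2, (abs_le.mp (abs_boundaryHeat_le hM₀ t z)).1]
  have hge : boundaryHeat h t z - V t z ≤ 0 := by
    refine quarterPlane_heat_nonpos (D := fun t z => boundaryHeat h t z - V t z) (M := M + M₀)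
      (fun t ht z hz => ?_) (hUc.sub hVcont)
      (fun t ht z hz => (hUt t z).sub (hVt t ht z hz).hasDerivAt_deriv_two.1)
      (fun t ht z hz => (hUz t z hz).sub (hVz t ht z hz).hasDerivAt_deriv_two.1)
      (fun t ht z hz => (hUzz t z hz).sub (hVz t ht z hz).hasDerivAt_deriv_two.2)
      (fun t ht z hz => by rw [hheat t ht z hz, hUheat t z hz])
      (fun z hz => by rw [hic z hz, hUi z, sub_zero])
      (fun t ht => by rw [hbc t ht, boundaryHeat_zero_right, sub_self]) ht hz
    linarith [(abs_le.mp (hVbdd t ht z hz)).1, (abs_le.mp (abs_boundaryHeat_le hM₀ t z)).2]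
  linarith

lemma exists_pos_le_of_abs_deriv_eq_one {φ : ℝ → ℝ}
    (hφs : ContDiffOn ℝ (⊤ : ℕ∞) φ (Set.Icc (-1:ℝ) 1))
    (hφrange : ∀ y ∈ Set.Icc (-1:ℝ) 1, φ y ∈ Set.Icc (0:ℝ) 1)
    (hφm1 : φ (-1) = 0) (hφ1 : φ 1 = 0)
    (hφ' : ∀ y ∈ Set.Icc (-1:ℝ) 1, 1/4 ≤ |y| → |deriv φ y| = 1) :
    ∃ c > (0:ℝ), ∀ y : ℝ, 1/3 ≤ |y| → |y| ≤ 2/3 → c ≤ φ y := by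
  have hsub : ∀ y : ℝ, |y| ≤ 2/3 → y ∈ Set.Icc (-1:ℝ) 1 := fun y hy =>
    abs_le.mp (hy.trans (by norm_num))
  have hpos : ∀ y : ℝ, 1/3 ≤ |y| → |y| ≤ 2/3 → 0 < φ y := by
    intro y hy1 hy2
    refine lt_of_le_of_ne (hφrange y (hsub y hy2)).1 fun h0 => ?_
    have hcont := hφs.continuousOn
    have hy2' := abs_le.mp hy2
    rcases le_total 0 y with hy | hy
    · rw [abs_of_nonneg hy] at hy1
      obtain ⟨x, hx, hx0⟩ := exists_deriv_eq_zero (f := φ) (show y < 1 by linarith)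
        (hcont.mono (Set.Icc_subset_Icc (by linarith) le_rfl)) (by rw [← h0, hφ1])
      have := hφ' x ⟨by linarith [hx.1], hx.2.le⟩ ((show 1/4 ≤ x by linarith [hx.1]).trans
        (le_abs_self x))
      rw [hx0] at this
      norm_num at this
    · rw [abs_of_nonpos hy] at hy1
      obtain ⟨x, hx, hx0⟩ := exists_deriv_eq_zero (f := φ) (show -1 < y by linarith)
        (hcont.mono (Set.Icc_subset_Icc le_rfl (by linarith))) (by rw [← h0, hφm1])
      have := hφ' x ⟨hx.1.le, by linarith [hx.2]⟩ ((show 1/4 ≤ -x by linarith [hx.2]).trans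
        (neg_le_abs x))
      rw [hx0] at this
      norm_num at this
  have hSc : IsCompact (Set.Icc (-1:ℝ) 1 ∩ {y | 1/3 ≤ |y| ∧ |y| ≤ 2/3}) := by
    refine isCompact_Icc.inter_right ?_
    exact (isClosed_le continuous_const continuous_abs).inter
      (isClosed_le continuous_abs continuous_const)
  obtain ⟨x, ⟨-, hx1, hx2⟩, hmin⟩ := hSc.exists_isMinOn
    ⟨1/2, ⟨by norm_num, by norm_num⟩, by rw [abs_of_pos] <;> norm_num,
      by rw [abs_of_pos] <;> norm_num⟩ (hφs.continuousOn.mono Set.inter_subset_left)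
  exact ⟨φ x, hpos x hx1 hx2, fun y hy1 hy2 => hmin ⟨hsub y hy2, hy1, hy2⟩⟩

lemma exists_abs_deriv_le {χ : ℝ → ℝ} (hχs : ContDiffOn ℝ (⊤ : ℕ∞) χ (Set.Icc (-1:ℝ) 1)) :
    ∃ X > (0:ℝ), ∀ y : ℝ, |y| ≤ 2/3 → |deriv χ y| ≤ X ∧ |iteratedDeriv 2 χ y| ≤ X := by
  have hsub : Set.Icc (-(2/3):ℝ) (2/3) ⊆ Set.Ioo (-1) 1 := fun y hy =>
    ⟨by linarith [hy.1], by linarith [hy.2]⟩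
  have h1 : ContDiffOn ℝ 2 χ (Set.Ioo (-1:ℝ) 1) :=
    (hχs.mono Set.Ioo_subset_Icc_self).of_le ENat.LEInfty.out
  have h2 : ContDiffOn ℝ 1 (deriv χ) (Set.Ioo (-1:ℝ) 1) :=
    h1.deriv_of_isOpen isOpen_Ioo (by norm_num)
  have h3 : ContinuousOn (iteratedDeriv 2 χ) (Set.Ioo (-1:ℝ) 1) := by
    rw [iteratedDeriv_succ, iteratedDeriv_one]
    exact h2.continuousOn_deriv_of_isOpen isOpen_Ioo le_rfl
  obtain ⟨A, hA⟩ := isCompact_Icc.exists_bound_of_continuousOn (h2.continuousOn.mono hsub)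
  obtain ⟨B, hB⟩ := isCompact_Icc.exists_bound_of_continuousOn (h3.mono hsub)
  refine ⟨max (max A B) 1, by positivity, fun y hy => ⟨?_, ?_⟩⟩
  · exact (hA y (abs_le.mp hy)).trans ((le_max_left A B).trans (le_max_left _ _))
  · exact (hB y (abs_le.mp hy)).trans ((le_max_right A B).trans (le_max_left _ _))

lemma fWsource_eq_zero_of_eventually_const {χ φ : ℝ → ℝ} {V : ℝ → ℝ → ℝ} {ε t y k : ℝ}
    (h : χ =ᶠ[nhds y] fun _ => k) : fWsource χ φ V ε t y = 0 := by
  have h1 : deriv χ =ᶠ[nhds y] fun _ => 0 := by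
    filter_upwards [h.eventuallyEq_nhds] with x hx
    rw [hx.deriv_eq, deriv_const]
  have h2 : iteratedDeriv 2 χ y = 0 := by
    rw [iteratedDeriv_succ, iteratedDeriv_one, h1.deriv_eq, deriv_const]
  simp [fWsource, h2, h1.self_of_nhds]

lemma abs_fWsource_le {χ φ : ℝ → ℝ} {V : ℝ → ℝ → ℝ} {ε t y X c C : ℝ} (hε : 0 < ε) (hc : 0 < c)
    (hC : 0 ≤ C) (hX : 0 ≤ X) (hφ : c ≤ φ y) (hφ' : |deriv φ y| = 1) (hχ1 : |deriv χ y| ≤ X)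
    (hχ2 : |iteratedDeriv 2 χ y| ≤ X)
    (hV : ∀ z > (0:ℝ), |V t z| ≤ C / z ^ 4 ∧ |deriv (V t) z| ≤ C / z ^ 5) :
    |fWsource χ φ V ε t y| ≤ (X * C / c ^ 4 + 2 * X * C / c ^ 5) * ε := by
  have hr : 0 < Real.sqrt ε := Real.sqrt_pos.mpr hε
  have hr2 : ε = Real.sqrt ε ^ 2 := (Real.sq_sqrt hε.le).symm
  rw [fWsource]
  set r := Real.sqrt ε
  set p := φ y
  have hp : 0 < p := hc.trans_le hφ
  obtain ⟨hV1, hV2⟩ := hV (p / r) (by positivity)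
  refine (abs_sub _ _).trans ?_
  rw [add_mul]
  refine add_le_add ?_ ?_
  · rw [abs_mul, abs_mul, abs_neg, abs_div, abs_of_pos (show 0 < p ^ 2 by positivity),
      abs_of_pos (show 0 < (p / r) ^ 2 by positivity)]
    calc _ ≤ X / p ^ 2 * (p / r) ^ 2 * (C / (p / r) ^ 4) := by gcongr
      _ = X * C / p ^ 4 * r ^ 2 := by field_simp
      _ ≤ X * C / c ^ 4 * ε := by rw [← hr2]; gcongr
  · rw [abs_mul, abs_mul, abs_mul, abs_mul, abs_div, hφ', mul_one,
      abs_of_pos (show 0 < p ^ 3 by positivity), abs_of_pos (show 0 < (p / r) ^ 3 by positivity),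
      abs_of_pos (show (0:ℝ) < 2 by norm_num)]
    calc _ ≤ 2 * (X / p ^ 3) * (p / r) ^ 3 * (C / (p / r) ^ 5) := by gcongr
      _ = 2 * X * C / p ^ 5 * r ^ 2 := by field_simp
      _ ≤ 2 * X * C / c ^ 5 * ε := by rw [← hr2]; gcongr

/-- Lemma 4.3 of the paper: uniform estimate on the technical
profile `W^ε` solving `∂_t W = ε ∂_{yy} W + f_W^ε` on `[-1,1]` with homogeneous
Dirichlet conditions and zero initial data: there is `C_W > 0` such that
`‖W^ε(t)‖_{L^∞} + ‖∂_y W^ε(t)‖_{L^∞} ≤ ε^{-3/4} C_W` for all `ε ∈ (0,1)`, `t ≥ 0`. -/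
theorem technical_profile_estimate
    (T : ℝ) (hT : 0 < T) (n : ℕ) (hn : 3 ≤ n)
    (h : ℝ → ℝ) (hsmooth : ContDiff ℝ (⊤ : ℕ∞) h)
    (hsupp : Function.support h ⊆ Set.Ioc 0 (T/3) ∪ Set.Ico (2*T/3) T)
    (hmom : ∀ k : ℕ, k < n → ∫ t in (0:ℝ)..T, t ^ k * h t = 0)
    (V : ℝ → ℝ → ℝ)
    (hVbdd : ∃ M : ℝ, ∀ t ≥ (0:ℝ), ∀ z ≥ (0:ℝ), |V t z| ≤ M)
    (hVcont : ContinuousOn (fun p : ℝ × ℝ => V p.1 p.2)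
      (Set.Ici (0:ℝ) ×ˢ Set.Ici (0:ℝ)))
    (hVsmooth : ContDiffOn ℝ (⊤ : ℕ∞) (fun p : ℝ × ℝ => V p.1 p.2)
      (Set.Ioi (0:ℝ) ×ˢ Set.Ici (0:ℝ)))
    (hheat : ∀ t > (0:ℝ), ∀ z > (0:ℝ),
      deriv (fun τ => V τ z) t = iteratedDeriv 2 (V t) z)
    (hbc : ∀ t ≥ (0:ℝ), V t 0 = h t)
    (hic : ∀ z ≥ (0:ℝ), V 0 z = 0)
    (hVfin : ∀ α ≤ 3, ∀ t ≥ (0:ℝ),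
      IntegrableOn (fun z => (1 + z ^ 2) ^ 3 * (iteratedDeriv α (V t) z) ^ 2)
        (Set.Ioi (0:ℝ)))
    (hVlocbdd : ∀ K > (0:ℝ), ∃ M : ℝ,
      ∀ t ∈ Set.Icc (0:ℝ) K, weightedSobolevNorm 3 3 (V t) ≤ M)
    (χ : ℝ → ℝ) (hχs : ContDiffOn ℝ (⊤ : ℕ∞) χ (Set.Icc (-1:ℝ) 1))
    (hχrange : ∀ y ∈ Set.Icc (-1:ℝ) 1, χ y ∈ Set.Icc (0:ℝ) 1)
    (hχ1 : ∀ y ∈ Set.Icc (-1:ℝ) 1, 2/3 ≤ |y| → χ y = 1)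
    (hχ0 : ∀ y ∈ Set.Icc (-1:ℝ) 1, |y| ≤ 1/3 → χ y = 0)
    (φ : ℝ → ℝ) (hφs : ContDiffOn ℝ (⊤ : ℕ∞) φ (Set.Icc (-1:ℝ) 1))
    (hφrange : ∀ y ∈ Set.Icc (-1:ℝ) 1, φ y ∈ Set.Icc (0:ℝ) 1)
    (hφm1 : φ (-1) = 0) (hφ1 : φ 1 = 0)
    (hφ' : ∀ y ∈ Set.Icc (-1:ℝ) 1, 1/4 ≤ |y| → |deriv φ y| = 1) :
    ∃ C_W > (0:ℝ), ∀ ε ∈ Set.Ioo (0:ℝ) 1, ∀ W : ℝ → ℝ → ℝ,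
      ContDiffOn ℝ (⊤ : ℕ∞) (uncurry W) (Set.Ici (0:ℝ) ×ˢ Set.Icc (-1:ℝ) 1) →
      (∀ t > (0:ℝ), ∀ y ∈ Set.Ioo (-1:ℝ) 1,
        deriv (fun τ => W τ y) t =
          ε * iteratedDeriv 2 (W t) y + fWsource χ φ V ε t y) →
      (∀ t ≥ (0:ℝ), W t (-1) = 0 ∧ W t 1 = 0) →
      (∀ y : ℝ, W 0 y = 0) →
      ∀ t ≥ (0:ℝ),
        (⨆ y : Set.Icc (-1:ℝ) 1, |W t (y : ℝ)|) +
            (⨆ y : Set.Icc (-1:ℝ) 1, |deriv (W t) (y : ℝ)|) ≤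
          ε ^ (-(3:ℝ)/4) * C_W := by
  have h0 : ∀ t ∉ Set.Ioo 0 T, h t = 0 := by
    intro t ht
    by_contra hne
    rcases hsupp hne with h1 | h1
    · exact ht ⟨h1.1, by linarith [h1.2]⟩
    · exact ht ⟨by linarith [h1.1], h1.2⟩
  have hc := hsmooth.continuous
  have hm0 : ∫ t in (0:ℝ)..T, h t = 0 := by simpa using hmom 0 (by omega)
  have hm1 : ∫ t in (0:ℝ)..T, t * h t = 0 := by simpa using hmom 1 (by omega)
  obtain ⟨M₀, hM₀⟩ := exists_abs_le_of_eq_zero_off_Ioo hc h0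
  have hsupp' : HasCompactSupport h := HasCompactSupport.intro isCompact_Icc
    (fun t ht => h0 t fun h' => ht (Set.Ioo_subset_Icc_self h'))
  obtain ⟨M', hM'⟩ := hsupp'.deriv.exists_bound_of_continuous (hsmooth.continuous_deriv (by simp))
  obtain ⟨g₁, g₂, hg₁, hg₂, ⟨M₁, hM₁⟩, ⟨M₂, hM₂⟩⟩ :=
    exists_bounded_second_primitive hc h0 hm0 hm1
  obtain ⟨C, hC, hdecay⟩ := exists_boundaryHeat_decay hc hg₁ hg₂ hM₀ hM₁ hM₂
  obtain ⟨M, hM⟩ := hVbdd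
  have hVU : ∀ t ≥ (0:ℝ), ∀ z ≥ (0:ℝ), V t z = boundaryHeat h t z := fun t ht z hz =>
    eq_boundaryHeat hsmooth hM₀ hM' (fun t ht => h0 t fun h' => by linarith [h'.1]) hM hVcont
      hVsmooth hheat hbc hic ht hz
  have hV : ∀ t > (0:ℝ), ∀ z > (0:ℝ),
      |V t z| ≤ C / z ^ 4 ∧ |deriv (V t) z| ≤ C / z ^ 5 := by
    intro t ht z hz
    have h1 : V t =ᶠ[nhds z] boundaryHeat h t := by
      filter_upwards [Ioi_mem_nhds hz] with w hw using hVU t ht.le w (le_of_lt hw)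
    rw [h1.deriv_eq, hVU t ht.le z hz.le]
    exact hdecay t z hz
  obtain ⟨c, hc0, hφc⟩ := exists_pos_le_of_abs_deriv_eq_one hφs hφrange hφm1 hφ1 hφ'
  obtain ⟨X, hX, hχd⟩ := exists_abs_deriv_le hχs
  set B : ℝ := X * C / c ^ 4 + 2 * X * C / c ^ 5 + 1 with hB
  have hB0 : 0 < B := by positivity
  have hsource : ∀ ε > (0:ℝ), ∀ t > (0:ℝ), ∀ y ∈ Set.Ioo (-1:ℝ) 1,
      |fWsource χ φ V ε t y| < B * ε := by
    intro ε hε t ht y hy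
    rcases lt_or_ge |y| (1/3) with h1 | h1
    · rw [fWsource_eq_zero_of_eventually_const (k := 0), abs_zero]
      · positivity
      · filter_upwards [continuous_abs.continuousAt.eventually (Iio_mem_nhds h1),
          Ioo_mem_nhds hy.1 hy.2] with x hx hx'
        exact hχ0 x ⟨hx'.1.le, hx'.2.le⟩ (le_of_lt hx)
    rcases lt_or_ge (2/3) |y| with h2 | h2
    · rw [fWsource_eq_zero_of_eventually_const (k := 1), abs_zero]
      · positivity
      · filter_upwards [continuous_abs.continuousAt.eventually (Ioi_mem_nhds h2),
          Ioo_mem_nhds hy.1 hy.2] with x hx hx'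
        exact hχ1 x ⟨hx'.1.le, hx'.2.le⟩ (le_of_lt hx)
    refine (abs_fWsource_le hε hc0 hC hX.le (hφc y h1 h2)
      (hφ' y ⟨hy.1.le, hy.2.le⟩ (le_trans (by norm_num) h1)) (hχd y h2).1 (hχd y h2).2
      (hV t ht)).trans_lt ?_
    rw [hB]
    nlinarith
  refine ⟨3 * B, by positivity, fun ε hε W hWs hWeq hWbc hWic t ht => ?_⟩
  have hWat : ∀ t > (0:ℝ), ∀ y ∈ Set.Ioo (-1:ℝ) 1,
      ContDiffAt ℝ (⊤ : ℕ∞) (uncurry W) (t, y) := fun t ht y hy =>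
    hWs.contDiffAt (prod_mem_nhds (Ici_mem_nhds ht) (Icc_mem_nhds hy.1 hy.2))
  have hWy : ∀ t > (0:ℝ), ∀ y ∈ Set.Ioo (-1:ℝ) 1, ContDiffAt ℝ (⊤ : ℕ∞) (W t) y :=
    fun t ht y hy => (hWat t ht y hy).comp (f := fun y : ℝ => (t, y)) y (by fun_prop)
  have hWt : ∀ t > (0:ℝ), ∀ y ∈ Set.Ioo (-1:ℝ) 1, ContDiffAt ℝ (⊤ : ℕ∞) (fun τ => W τ y) t :=
    fun t ht y hy => (hWat t ht y hy).comp (f := fun τ : ℝ => (τ, y)) t (by fun_prop)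
  have hsol : IsForcedHeatSolution ε (B * ε) W (fun t y => deriv (fun τ => W τ y) t)
      (fun t => deriv (W t)) (fun t => iteratedDeriv 2 (W t)) :=
    { cont := hWs.continuousOn
      deriv_time := fun t ht y hy => (hWt t ht y hy).hasDerivAt_deriv_two.1
      deriv_space := fun t ht y hy => (hWy t ht y hy).hasDerivAt_deriv_two.1
      deriv_space_two := fun t ht y hy => (hWy t ht y hy).hasDerivAt_deriv_two.2
      forcing := fun t ht y hy => by
        rw [hWeq t ht y hy, add_sub_cancel_left]
        exact hsource ε hε.1 t ht y hy
      left := fun t ht => (hWbc t ht).1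
      right := fun t ht => (hWbc t ht).2
      at_zero := fun y _ => hWic y }
  have hε0 : ε ≠ 0 := hε.1.ne'
  have hne : Nonempty (Set.Icc (-1:ℝ) 1) := ⟨⟨0, by norm_num, by norm_num⟩⟩
  have hsup : (⨆ y : Set.Icc (-1:ℝ) 1, |W t (y : ℝ)|) ≤ B := ciSup_le fun y => by
    have := hsol.abs_le hε.1 ht y.2
    rwa [mul_div_cancel_right₀ _ hε0] at this
  have hsup' : (⨆ y : Set.Icc (-1:ℝ) 1, |deriv (W t) (y : ℝ)|) ≤ 2 * B := ciSup_le fun y =>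
    abs_deriv_le_of_lipschitz_Icc (by positivity) (fun x hx => by
      have := hsol.abs_sub_le hε.1 ht hx y.2
      rwa [← mul_assoc, mul_div_cancel_right₀ _ hε0] at this) y.2
  have hpow : 1 ≤ ε ^ (-(3:ℝ)/4) :=
    Real.one_le_rpow_of_pos_of_le_one_of_nonpos hε.1 hε.2.le (by norm_num)
  nlinarith
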